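/- arXiv:2011.13304 — 7 statements merged into one kernel-verified Lean document; each statement's English description precedes it below -/
import Mathlib

section
/- Let E be a finite-dimensional real inner product space and let A be a self-adjoint endomorphism of E with a·id ≤ A ≤ b·id, where 0 < a ≤ b. Then for every ε with 0 < ε < 2a there exists t_ε > 0, depending only on a, b and ε, with the following property: every differentiable map S : (0,∞) → End(E) with S(t) self-adjoint for all t, satisfying the Riccati equation S'(t) = A² − S(t)² and the bounds a·tanh(at)·id ≤ S(t) ≤ b·coth(bt)·id for all t > 0, obeys ‖S(t) − A‖ < e^{−(2a−ε)(t−t_ε)} for all t > t_ε, where ‖·‖ is the operator norm. -/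
lemma aux_norm_le {E : Type} [NormedAddCommGroup E] [InnerProductSpace ℝ E]
    (T : E →L[ℝ] E) (hT : ∀ u v : E, (inner ℝ (T u) v : ℝ) = inner ℝ u (T v))
    (c : ℝ) (hc : 0 ≤ c) (h1 : ∀ u : E, (inner ℝ (T u) u : ℝ) ≤ c * ‖u‖ ^ 2)
    (h2 : ∀ u : E, -(c * ‖u‖ ^ 2) ≤ (inner ℝ (T u) u : ℝ)) : ‖T‖ ≤ c := by
  refine T.opNorm_le_bound hc fun u => ?_
  by_cases hTu : ‖T u‖ = 0
  · rw [hTu]; positivity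
  by_cases hu : ‖u‖ = 0
  · rw [norm_eq_zero] at hu; simp [hu]
  have hTp : 0 < ‖T u‖ := lt_of_le_of_ne (norm_nonneg _) (Ne.symm hTu)
  have hup : 0 < ‖u‖ := lt_of_le_of_ne (norm_nonneg _) (Ne.symm hu)
  set v : E := (‖u‖ / ‖T u‖) • T u with hv
  have hvn : ‖v‖ = ‖u‖ := by
    rw [hv, norm_smul, Real.norm_of_nonneg (by positivity)]
    field_simp
  have hin : (inner ℝ (T u) v : ℝ) = ‖u‖ * ‖T u‖ := by
    rw [hv, real_inner_smul_right, real_inner_self_eq_norm_sq]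
    field_simp
  have e1 := h1 (u + v)
  have e2 := h2 (u - v)
  have hs : (inner ℝ (T v) u : ℝ) = inner ℝ (T u) v := by
    rw [hT, real_inner_comm]
  rw [@norm_add_sq_real] at e1
  rw [@norm_sub_sq_real] at e2
  simp only [map_add, map_sub, inner_add_left, inner_add_right, inner_sub_left,
    inner_sub_right, hs, hin, hvn] at e1 e2
  have : ‖u‖ * ‖T u‖ ≤ ‖u‖ * (c * ‖u‖) := by nlinarith
  exact le_of_mul_le_mul_left this hup

lemma aux_one_sub {E : Type} [NormedAddCommGroup E] [InnerProductSpace ℝ E]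
    (T : E →L[ℝ] E) (hT : ∀ u v : E, (inner ℝ (T u) v : ℝ) = inner ℝ u (T v))
    (m h : ℝ) (hm : ∀ u : E, m * ‖u‖ ^ 2 ≤ (inner ℝ (T u) u : ℝ))
    (h0 : 0 ≤ h) (h1 : h * ‖T‖ ≤ 1) (h2 : h * m ≤ 1) :
    ‖(1 : E →L[ℝ] E) - h • T‖ ≤ 1 - h * m := by
  have key : ∀ u : E, (inner ℝ (((1 : E →L[ℝ] E) - h • T) u) u : ℝ)
      = ‖u‖ ^ 2 - h * inner ℝ (T u) u := by
    intro u
    simp [inner_sub_left, real_inner_smul_left]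
  refine aux_norm_le _ ?_ _ (by linarith) ?_ ?_
  · intro u v
    simp [inner_sub_left, inner_sub_right, real_inner_smul_left, real_inner_smul_right, hT]
  · intro u
    rw [key]
    nlinarith [mul_le_mul_of_nonneg_left (hm u) h0]
  · intro u
    rw [key]
    have : (inner ℝ (T u) u : ℝ) ≤ ‖T‖ * ‖u‖ ^ 2 := by
      calc (inner ℝ (T u) u : ℝ) ≤ ‖T u‖ * ‖u‖ := real_inner_le_norm _ _
        _ ≤ (‖T‖ * ‖u‖) * ‖u‖ := by gcongr; exact T.le_opNorm u
        _ = _ := by ring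
    nlinarith [mul_le_mul_of_nonneg_left this h0, sq_nonneg ‖u‖,
      mul_nonneg (sub_nonneg.2 h1) (sq_nonneg ‖u‖), mul_nonneg (sub_nonneg.2 h2) (sq_nonneg ‖u‖)]

lemma aux_dini {E : Type} [NormedAddCommGroup E] [InnerProductSpace ℝ E]
    (A : E →L[ℝ] E) (S : ℝ → (E →L[ℝ] E)) (x a m r : ℝ)
    (hA : ∀ u v : E, (inner ℝ (A u) v : ℝ) = inner ℝ u (A v))
    (hS : ∀ u v : E, (inner ℝ (S x u) v : ℝ) = inner ℝ u (S x v))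
    (hAa : ∀ u : E, a * ‖u‖ ^ 2 ≤ (inner ℝ (A u) u : ℝ))
    (hSm : ∀ u : E, m * ‖u‖ ^ 2 ≤ (inner ℝ (S x u) u : ℝ))
    (hd : HasDerivAt S (A ^ 2 - (S x) ^ 2) x)
    (hr : -(a + m) * ‖S x - A‖ < r) :
    ∀ᶠ z in nhdsWithin x (Set.Ioi x), (z - x)⁻¹ * (‖S z - A‖ - ‖S x - A‖) < r := by
  set D := S x - A with hD
  set P : ℝ → (E →L[ℝ] E) := fun z => (1 - (z - x) • A) * D * (1 - (z - x) • S x) with hP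
  have hlin : ∀ T : E →L[ℝ] E, HasDerivAt (fun z : ℝ => (1 : E →L[ℝ] E) - (z - x) • T) (-T) x := by
    intro T
    have := (((hasDerivAt_id x).sub_const x).smul_const T).const_sub (1 : E →L[ℝ] E)
    simpa using this
  have hPd : HasDerivAt P (A ^ 2 - (S x) ^ 2) x := by
    have := ((hlin A).mul_const D).mul (hlin (S x))
    have e : A ^ 2 - (S x) ^ 2 = (-A * D) * (1 - (x - x) • S x)
        + ((1 - (x - x) • A) * D) * (-S x) := by
      rw [sub_self, zero_smul, zero_smul, hD]
      noncomm_ring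
    rw [e]
    exact this
  have hQ : HasDerivAt (fun z => (S z - A) - P z) 0 x := by
    have := (hd.sub_const A).sub hPd
    rw [sub_self] at this
    exact this
  set c := (r - (-(a + m) * ‖D‖)) / 2 with hc
  have hcp : 0 < c := by rw [hc]; linarith
  have hQe := (hasDerivAt_iff_isLittleO.1 hQ).def hcp
  have lim : ∀ k : ℝ, Filter.Tendsto (fun z : ℝ => (z - x) * k) (nhds x) (nhds 0) := by
    intro k
    have : Continuous (fun z : ℝ => (z - x) * k) := by fun_prop
    simpa using this.tendsto x
  have g : ∀ k d : ℝ, 0 < d → ∀ᶠ z in nhdsWithin x (Set.Ioi x), (z - x) * k < d := fun k d hd =>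
    ((lim k).eventually (gt_mem_nhds hd)).filter_mono nhdsWithin_le_nhds
  filter_upwards [hQe.filter_mono nhdsWithin_le_nhds, g ‖A‖ 1 one_pos, g ‖S x‖ 1 one_pos,
    g a 1 one_pos, g m 1 one_pos, g (a * m * ‖D‖) c hcp, self_mem_nhdsWithin]
    with z h1 h2 h3 h4 h5 h6 hz
  have hz : 0 < z - x := sub_pos.2 hz
  have n1 := aux_one_sub A hA a (z - x) hAa hz.le h2.le h4.le
  have n2 := aux_one_sub (S x) hS m (z - x) hSm hz.le h3.le h5.le
  have n3 : ‖P z‖ ≤ (1 - (z - x) * a) * ‖D‖ * (1 - (z - x) * m) := by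
    refine (norm_mul_le _ _).trans ?_
    have : ‖(1 - (z - x) • A) * D‖ ≤ (1 - (z - x) * a) * ‖D‖ :=
      (norm_mul_le _ _).trans (by gcongr)
    gcongr
  have hPx : P x = S x - A := by simp [hP, hD]
  have n4 : ‖(S z - A) - P z‖ ≤ c * (z - x) := by
    simpa [hPx, abs_of_pos hz] using h1
  have n5 : ‖S z - A‖ ≤ ‖(S z - A) - P z‖ + ‖P z‖ := by
    simpa using norm_add_le ((S z - A) - P z) (P z)
  rw [inv_mul_lt_iff₀ hz]
  have e : r = 2 * c + (-(a + m) * ‖D‖) := by rw [hc]; ring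
  rw [e]
  have h6' := mul_lt_mul_of_pos_left h6 hz
  nlinarith

lemma aux_decay {E : Type} [NormedAddCommGroup E] [InnerProductSpace ℝ E]
    (A : E →L[ℝ] E) (S : ℝ → (E →L[ℝ] E)) (a m t0 t : ℝ) (ht : t0 ≤ t)
    (hA : ∀ u v : E, (inner ℝ (A u) v : ℝ) = inner ℝ u (A v))
    (hAa : ∀ u : E, a * ‖u‖ ^ 2 ≤ (inner ℝ (A u) u : ℝ))
    (hS : ∀ x, t0 ≤ x → ∀ u v : E, (inner ℝ (S x u) v : ℝ) = inner ℝ u (S x v))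
    (hSm : ∀ x, t0 ≤ x → ∀ u : E, m * ‖u‖ ^ 2 ≤ (inner ℝ (S x u) u : ℝ))
    (hd : ∀ x, t0 ≤ x → HasDerivAt S (A ^ 2 - (S x) ^ 2) x) :
    ‖S t - A‖ ≤ ‖S t0 - A‖ * Real.exp (-(a + m) * (t - t0)) := by
  have := le_gronwallBound_of_liminf_deriv_right_le (f := fun z => ‖S z - A‖)
    (f' := fun z => -(a + m) * ‖S z - A‖) (δ := ‖S t0 - A‖) (K := -(a + m)) (ε := 0)
    (a := t0) (b := t) ?_ ?_ le_rfl ?_ t ⟨ht, le_rfl⟩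
  · simpa [gronwallBound_ε0] using this
  · intro x hx
    exact ((hd x hx.1).continuousAt.sub continuousAt_const).norm.continuousWithinAt
  · intro x hx r hr
    exact (aux_dini A S x a m r hA (hS x hx.1) hAa (hSm x hx.1) (hd x hx.1) hr).frequently
  · intro x _
    simp

lemma aux_tanh (a ε : ℝ) (ha : 0 < a) (hε : 0 < ε) :
    ∃ t0 : ℝ, 0 < t0 ∧ ∀ t, t0 ≤ t → a - ε ≤ a * Real.tanh (a * t) := by
  refine ⟨1 / ε, by positivity, fun t ht => ?_⟩
  have htp : 0 < t := lt_of_lt_of_le (by positivity) ht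
  have h1 : 1 ≤ ε * t := by
    rw [div_le_iff₀ hε] at ht; linarith
  set y := a * t with hy
  have hyp : 0 < y := by positivity
  have hc := Real.cosh_pos y
  have hsub : Real.cosh y - Real.sinh y = Real.exp (-y) := by
    exact Real.cosh_sub_sinh y
  rw [Real.tanh_eq_sinh_div_cosh]
  have hc2 : 2 * Real.cosh y = Real.exp y + Real.exp (-y) := by
    rw [Real.cosh_eq]; ring
  have hs1 : Real.exp (-y) ≤ 1 := Real.exp_le_one_iff.2 (by linarith)
  have hk : y ≤ Real.sinh y := Real.self_le_sinh_iff.2 hyp.le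
  have hk2 : y ≤ Real.cosh y := by linarith [Real.exp_pos (-y)]
  have : a * Real.exp (-y) ≤ ε * Real.cosh y := by
    calc a * Real.exp (-y) ≤ a * 1 := by gcongr
      _ ≤ a * (ε * t) := by gcongr
      _ = ε * y := by rw [hy]; ring
      _ ≤ _ := by gcongr
  rw [mul_div_assoc', le_div_iff₀ hc]
  have : a * Real.cosh y - a * Real.sinh y ≤ ε * Real.cosh y := by
    rw [← mul_sub, hsub]; exact this
  linarith


/-- Real hyperbolic cotangent. -/
noncomputable def Real.coth (x : ℝ) : ℝ := Real.cosh x / Real.sinh x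

/-- Let `E` be a finite-dimensional real inner product space and `A` a self-adjoint
endomorphism with `a·id ≤ A ≤ b·id`, `0 < a ≤ b`. For every `0 < ε < 2a` there is
`t_ε > 0`, depending only on `a`, `b`, `ε`, such that every differentiable family
`S : (0,∞) → End(E)` of self-adjoint endomorphisms satisfying the Riccati equation
`S' = A² − S²` and `a tanh(at) ≤ S(t) ≤ b coth(bt)` obeys
`‖S(t) − A‖ < e^{−(2a−ε)(t−t_ε)}` for all `t > t_ε`. -/
theorem riccati_exponential_convergence
    (a b ε : ℝ) (ha : 0 < a) (hab : a ≤ b) (hε : 0 < ε) (hε2a : ε < 2 * a) :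
    ∃ tε : ℝ, 0 < tε ∧
      ∀ (E : Type) [NormedAddCommGroup E] [InnerProductSpace ℝ E] [FiniteDimensional ℝ E]
        (A : E →L[ℝ] E),
        (∀ u v : E, (inner ℝ (A u) v : ℝ) = inner ℝ u (A v)) →
        (∀ u : E, a * ‖u‖ ^ 2 ≤ (inner ℝ (A u) u : ℝ)) →
        (∀ u : E, (inner ℝ (A u) u : ℝ) ≤ b * ‖u‖ ^ 2) →
        ∀ S : ℝ → (E →L[ℝ] E),
          (∀ t : ℝ, 0 < t → HasDerivAt S (A ^ 2 - (S t) ^ 2) t) →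
          (∀ t : ℝ, 0 < t → ∀ u v : E, (inner ℝ (S t u) v : ℝ) = inner ℝ u (S t v)) →
          (∀ t : ℝ, 0 < t → ∀ u : E,
            a * Real.tanh (a * t) * ‖u‖ ^ 2 ≤ (inner ℝ (S t u) u : ℝ)) →
          (∀ t : ℝ, 0 < t → ∀ u : E,
            (inner ℝ (S t u) u : ℝ) ≤ b * Real.coth (b * t) * ‖u‖ ^ 2) →
          ∀ t : ℝ, tε < t → ‖S t - A‖ < Real.exp (-(2 * a - ε) * (t - tε)) := by
  obtain ⟨t0, ht0, hth⟩ := aux_tanh a ε ha hε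
  have hb : 0 < b := lt_of_lt_of_le ha hab
  have hbt : 0 < b * t0 := by positivity
  have hcoth : 0 ≤ Real.coth (b * t0) :=
    div_nonneg (Real.cosh_pos _).le (Real.sinh_pos_iff.2 hbt).le
  set M : ℝ := b + b * Real.coth (b * t0) with hM
  have hM0 : 0 < M := by positivity
  have hk : 0 < 2 * a - ε := by linarith
  refine ⟨t0 + M / (2 * a - ε), by positivity, ?_⟩
  intro E _ _ _ A hA hAa hAb S hd hS hSl hSu t ht
  have htt : t0 ≤ t := by
    have : 0 < M / (2 * a - ε) := by positivity
    linarith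
  have hdec := aux_decay A S a (a - ε) t0 t htt hA hAa
    (fun x hx => hS x (ht0.trans_le hx))
    (fun x hx u => (mul_le_mul_of_nonneg_right (hth x hx) (sq_nonneg _)).trans
      (hSl x (ht0.trans_le hx) u))
    (fun x hx => hd x (ht0.trans_le hx))
  have hD0 : ‖S t0 - A‖ ≤ M := by
    have htan : 0 ≤ a * Real.tanh (a * t0) := by
      rw [Real.tanh_eq_sinh_div_cosh]
      have h1 : 0 < a * t0 := by positivity
      exact mul_nonneg ha.le (div_nonneg (Real.sinh_pos_iff.2 h1).le (Real.cosh_pos _).le)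
    have hbc : 0 ≤ b * Real.coth (b * t0) := by positivity
    refine aux_norm_le _ ?_ _ hM0.le ?_ ?_
    · intro u v
      simp [inner_sub_left, inner_sub_right, hA, hS t0 ht0]
    · intro u
      have h1 := hSu t0 ht0 u
      have h2 := hAa u
      have h3 : 0 ≤ a * ‖u‖ ^ 2 := by positivity
      have h4 : 0 ≤ b * ‖u‖ ^ 2 := by positivity
      rw [sub_apply, inner_sub_left, hM, add_mul]
      linarith
    · intro u
      have h1 := hSl t0 ht0 u
      have h2 := hAb u
      have h3 : 0 ≤ a * Real.tanh (a * t0) * ‖u‖ ^ 2 := by positivity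
      have h4 : 0 ≤ b * Real.coth (b * t0) * ‖u‖ ^ 2 := by positivity
      rw [sub_apply, inner_sub_left, hM, add_mul]
      linarith
  have hMe : M < Real.exp M := by linarith [Real.add_one_le_exp M]
  calc ‖S t - A‖ ≤ ‖S t0 - A‖ * Real.exp (-(a + (a - ε)) * (t - t0)) := hdec
    _ ≤ M * Real.exp (-(a + (a - ε)) * (t - t0)) := by gcongr
    _ < Real.exp M * Real.exp (-(a + (a - ε)) * (t - t0)) := by gcongr
    _ = _ := by
      rw [← Real.exp_add]
      congr 1
      have e : (2 * a - ε) * (M / (2 * a - ε)) = M := mul_div_cancel₀ M hk.ne'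
      linear_combination -e
end

section
/- Let E be a finite-dimensional real inner product space and let A be a self-adjoint endomorphism of E with a·id ≤ A ≤ b·id, where 0 < a ≤ b. Let 0 < ε < 2a and t₀ ∈ ℝ, and let S : [t₀,∞) → End(E) be differentiable with S(t) self-adjoint for all t ≥ t₀, satisfying the Riccati equation S'(t) = A² − S(t)² and the lower bound S(t) ≥ (a − ε)·id for all t ≥ t₀. Then ‖S(t) − A‖ ≤ e^{−(2a−ε)(t−t₀)}·‖S(t₀) − A‖ for all t ≥ t₀, where ‖·‖ is the operator norm. -/
theorem riccati_aux_norm {E : Type*} [NormedAddCommGroup E] [InnerProductSpace ℝ E]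
    (M : E →L[ℝ] E) (c h : ℝ) (hh : 0 ≤ h)
    (hM : ∀ u : E, c * ‖u‖ ^ 2 ≤ (inner ℝ (M u) u : ℝ)) (D : E →L[ℝ] E) :
    ‖(1 - (h / 2) • M) * D * (1 - (h / 2) • M)‖ ≤ (1 - h * c + h ^ 2 * (‖M‖ ^ 2 / 4)) * ‖D‖ := by
  set q : ℝ := 1 - h * c + h ^ 2 * (‖M‖ ^ 2 / 4) with hq
  have key : ∀ u : E, ‖(1 - (h / 2) • M) u‖ ^ 2 ≤ q * ‖u‖ ^ 2 := by
    intro u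
    have e : (1 - (h / 2) • M) u = u - (h / 2) • M u := by simp
    rw [e, norm_sub_sq_real, real_inner_smul_right, norm_smul, real_inner_comm, mul_pow,
      Real.norm_eq_abs, sq_abs, hq]
    have h1 := hM u
    have h2 : ‖M u‖ ^ 2 ≤ ‖M‖ ^ 2 * ‖u‖ ^ 2 := by
      rw [← mul_pow]
      gcongr
      exact M.le_opNorm u
    nlinarith [mul_le_mul_of_nonneg_left h1 hh, mul_le_mul_of_nonneg_left h2 (sq_nonneg (h / 2))]
  rcases subsingleton_or_nontrivial E with hE | hE
  · have : D = 0 := Subsingleton.elim _ _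
    simp [this]
  have hq0 : 0 ≤ q := by
    obtain ⟨u, hu⟩ := exists_ne (0 : E)
    have h1 : 0 < ‖u‖ ^ 2 := by positivity
    have := (sq_nonneg _).trans (key u)
    exact nonneg_of_mul_nonneg_left this h1
  have hP : ‖(1 - (h / 2) • M)‖ ≤ √q := by
    apply ContinuousLinearMap.opNorm_le_bound _ (Real.sqrt_nonneg _)
    intro u
    refine (sq_le_sq₀ (norm_nonneg _) (by positivity)).1 ?_
    rw [mul_pow, Real.sq_sqrt hq0]
    exact key u
  calc _ ≤ ‖(1 - (h / 2) • M)‖ * ‖D‖ * ‖(1 - (h / 2) • M)‖ :=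
        (norm_mul_le _ _).trans (by gcongr; exact norm_mul_le _ _)
    _ ≤ √q * ‖D‖ * √q := by gcongr
    _ = q * ‖D‖ := by
        rw [mul_right_comm, Real.mul_self_sqrt hq0]

/-- Let `E` be a finite-dimensional real inner product space, `A` self-adjoint with
`a·id ≤ A ≤ b·id`, `0 < a ≤ b`, and `0 < ε < 2a`. If `S : [t₀,∞) → End(E)` is a
differentiable family of self-adjoint endomorphisms satisfying the Riccati equation
`S' = A² − S²` and `S(t) ≥ (a−ε)·id` for all `t ≥ t₀`, then
`‖S(t) − A‖ ≤ e^{−(2a−ε)(t−t₀)} ‖S(t₀) − A‖` for all `t ≥ t₀`. -/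
theorem riccati_decay_from_lower_bound
    {E : Type*} [NormedAddCommGroup E] [InnerProductSpace ℝ E] [FiniteDimensional ℝ E]
    (a b ε t₀ : ℝ) (ha : 0 < a) (hab : a ≤ b) (hε : 0 < ε) (hε2a : ε < 2 * a)
    (A : E →L[ℝ] E)
    (hAsym : ∀ u v : E, (inner ℝ (A u) v : ℝ) = inner ℝ u (A v))
    (hAa : ∀ u : E, a * ‖u‖ ^ 2 ≤ (inner ℝ (A u) u : ℝ))
    (hAb : ∀ u : E, (inner ℝ (A u) u : ℝ) ≤ b * ‖u‖ ^ 2)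
    (S : ℝ → (E →L[ℝ] E))
    (hS : ∀ t : ℝ, t₀ ≤ t → HasDerivWithinAt S (A ^ 2 - (S t) ^ 2) (Set.Ici t₀) t)
    (hSsym : ∀ t : ℝ, t₀ ≤ t → ∀ u v : E, (inner ℝ (S t u) v : ℝ) = inner ℝ u (S t v))
    (hSlow : ∀ t : ℝ, t₀ ≤ t → ∀ u : E, (a - ε) * ‖u‖ ^ 2 ≤ (inner ℝ (S t u) u : ℝ)) :
    ∀ t : ℝ, t₀ ≤ t →
      ‖S t - A‖ ≤ Real.exp (-(2 * a - ε) * (t - t₀)) * ‖S t₀ - A‖ := by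
  intro t ht
  have hcont : ContinuousOn (fun s => ‖S s - A‖) (Set.Icc t₀ t) := by
    have : ContinuousOn S (Set.Icc t₀ t) := fun s hs =>
      ((hS s hs.1).continuousWithinAt).mono Set.Icc_subset_Ici_self
    fun_prop
  have main := le_gronwallBound_of_liminf_deriv_right_le (f := fun s => ‖S s - A‖)
    (f' := fun s => -(2 * a - ε) * ‖S s - A‖) (δ := ‖S t₀ - A‖) (K := -(2 * a - ε)) (ε := 0)
    (a := t₀) (b := t) hcont ?_ le_rfl (fun x _ => by simp) t ⟨ht, le_rfl⟩
  · rw [gronwallBound_ε0] at main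
    rw [mul_comm]
    exact main
  intro x hx r hr
  apply Filter.Eventually.frequently
  set M := S x + A with hMdef
  set D := S x - A with hDdef
  have hM : ∀ u : E, (2 * a - ε) * ‖u‖ ^ 2 ≤ (inner ℝ (M u) u : ℝ) := by
    intro u
    have h1 := hSlow x hx.1 u
    have h2 := hAa u
    rw [hMdef, ContinuousLinearMap.add_apply, inner_add_left]
    linarith
  have hd : HasDerivWithinAt (fun z => S z - A -
      (1 - ((z - x) / 2) • M) * D * (1 - ((z - x) / 2) • M)) 0 (Set.Ioi x) x := by
    have hP : HasDerivAt (fun z : ℝ => (1 - ((z - x) / 2) • M)) (-((1 / 2 : ℝ) • M)) x := by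
      have := ((((hasDerivAt_id x).sub_const x).div_const 2).smul_const M).const_sub 1
      exact this
    have h1 := ((hP.mul_const D).mul hP).hasDerivWithinAt (s := Set.Ioi x)
    have h2 := ((hS x hx.1).mono (s := Set.Ioi x)
      (fun y hy => hx.1.trans (le_of_lt hy))).sub_const A
    refine (h2.sub h1).congr_deriv ?_
    have e : A ^ 2 - S x ^ 2 = -((1 / 2 : ℝ) • (M * D + D * M)) := by
      have : M * D + D * M = (2 : ℝ) • (S x ^ 2 - A ^ 2) := by
        rw [hMdef, hDdef, two_smul]; noncomm_ring
      rw [this, smul_smul]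
      norm_num
    rw [e]
    simp
    try abel
  have hlim := (hasDerivWithinAt_iff_tendsto_slope' (by simp)).1 hd
  have hl1 := hlim.norm
  have hl2 : Filter.Tendsto (fun z : ℝ => -(2 * a - ε) * ‖D‖ + (z - x) * (‖M‖ ^ 2 / 4 * ‖D‖))
      (nhdsWithin x (Set.Ioi x)) (nhds (-(2 * a - ε) * ‖D‖ + (x - x) * (‖M‖ ^ 2 / 4 * ‖D‖))) := by
    apply Filter.Tendsto.mono_left _ nhdsWithin_le_nhds
    apply Continuous.tendsto
    fun_prop
  have hl3 := hl2.add hl1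
  have hlt : -(2 * a - ε) * ‖D‖ + (x - x) * (‖M‖ ^ 2 / 4 * ‖D‖) + ‖(0 : E →L[ℝ] E)‖ < r := by
    simpa using hr
  filter_upwards [hl3.eventually_lt_const hlt, self_mem_nhdsWithin] with z hz hzx
  have hpos : 0 < z - x := sub_pos.2 hzx
  refine lt_of_le_of_lt ?_ hz
  have hb := riccati_aux_norm M (2 * a - ε) (z - x) hpos.le hM D
  set Q := (1 - ((z - x) / 2) • M) * D * (1 - ((z - x) / 2) • M) with hQ
  have hs : slope (fun z => S z - A -
      (1 - ((z - x) / 2) • M) * D * (1 - ((z - x) / 2) • M)) x z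
      = (z - x)⁻¹ • (S z - A - Q) := by
    simp [slope, hQ, hDdef]
  rw [hs, norm_smul, norm_inv, Real.norm_eq_abs, abs_of_pos hpos]
  have htri : ‖S z - A‖ ≤ ‖S z - A - Q‖ + ‖Q‖ := by
    simpa using norm_add_le (S z - A - Q) Q
  have e2 : -(2 * a - ε) * ‖D‖ + (z - x) * (‖M‖ ^ 2 / 4 * ‖D‖) + (z - x)⁻¹ * ‖S z - A - Q‖
      = (z - x)⁻¹ * ((z - x) * (-(2 * a - ε) * ‖D‖ + (z - x) * (‖M‖ ^ 2 / 4 * ‖D‖))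
        + ‖S z - A - Q‖) := by
    field_simp
  rw [e2]
  apply mul_le_mul_of_nonneg_left _ (by positivity)
  nlinarith
end

section
/- Let E be a finite-dimensional real inner product space and let A be a self-adjoint endomorphism of E with a·id ≤ A ≤ b·id, where 0 < a ≤ b. Let 0 < T < ∞ and let S : (0,T) → End(E) be differentiable with S(t) self-adjoint for all t, satisfying the Riccati equation S'(t) = A² − S(t)² and the bounds a·tanh(at)·id ≤ S(t) ≤ b·coth(bt)·id for all t ∈ (0,T). Then S is not a maximal solution: there exist T' > T and a differentiable map S̃ : (0,T') → End(E) with self-adjoint values satisfying S̃'(t) = A² − S̃(t)² on (0,T') and S̃(t) = S(t) for all t ∈ (0,T). -/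
open Set Metric

lemma riccati_lip {R : Type*} [NormedRing R] (B : R) (M : NNReal) :
    LipschitzOnWith (2 * M) (fun X : R => B - X ^ 2) (closedBall 0 M) := by
  apply LipschitzOnWith.of_dist_le_mul
  intro x hx y hy
  rw [mem_closedBall_zero_iff] at hx hy
  rw [dist_eq_norm, dist_eq_norm]
  have e : B - x ^ 2 - (B - y ^ 2) = -(x * (x - y) + (x - y) * y) := by noncomm_ring
  rw [e, norm_neg]
  have h1 := norm_add_le (x * (x - y)) ((x - y) * y)
  have h2 := norm_mul_le x (x - y)
  have h3 := norm_mul_le (x - y) y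
  have h4 := mul_le_mul_of_nonneg_right hx (norm_nonneg (x - y))
  have h5 := mul_le_mul_of_nonneg_left hy (norm_nonneg (x - y))
  push_cast
  linarith

lemma riccati_exists {R : Type*} [NormedRing R] [NormedAlgebra ℝ R] [CompleteSpace R]
    (B : R) (M : NNReal) :
    ∃ ε > (0 : ℝ), ∀ (t₀ : ℝ) (X : R), ‖X‖ ≤ M → ∃ α : ℝ → R, α t₀ = X ∧
      ∀ t ∈ Icc (t₀ - ε) (t₀ + ε),
        HasDerivWithinAt α (B - α t ^ 2) (Icc (t₀ - ε) (t₀ + ε)) t := by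
  set L : NNReal := ‖B‖₊ + (M + 1) ^ 2 with hL
  have hLpos : 0 < (L : ℝ) := by rw [hL]; push_cast; positivity
  refine ⟨1 / L, by positivity, fun t₀ X hX => ?_⟩
  have hε : 0 ≤ 1 / (L : ℝ) := by positivity
  have hpl : IsPicardLindelof (fun _ (X : R) => B - X ^ 2) (tmin := t₀ - 1 / L)
      (tmax := t₀ + 1 / L) ⟨t₀, by simp⟩ 0 (M + 1) M L (2 * (M + 1)) := by
    apply IsPicardLindelof.of_time_independent
    · intro x hx
      rw [mem_closedBall_zero_iff] at hx
      refine (norm_sub_le _ _).trans ?_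
      have h1 : ‖x ^ 2‖ ≤ ‖x‖ ^ 2 := norm_pow_le' x (by norm_num)
      have h2 : ‖x‖ ^ 2 ≤ ((M + 1 : NNReal) : ℝ) ^ 2 := pow_le_pow_left₀ (norm_nonneg _) hx 2
      rw [hL]
      push_cast at h2 ⊢
      linarith
    · exact riccati_lip B (M + 1)
    · simp only [add_sub_cancel_left, sub_sub_cancel, max_self]
      push_cast
      rw [mul_one_div_cancel hLpos.ne']
      linarith
  exact hpl.exists_eq_forall_mem_Icc_hasDerivWithinAt (mem_closedBall_zero_iff.2 hX)

lemma riccati_unique {R : Type*} [NormedRing R] [NormedAlgebra ℝ R]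
    (B : R) (M : ℝ) {a b t₀ : ℝ} {f g : ℝ → R} (ht : t₀ ∈ Ioo a b)
    (hf : ∀ t ∈ Ioo a b, HasDerivAt f (B - f t ^ 2) t ∧ ‖f t‖ ≤ M)
    (hg : ∀ t ∈ Ioo a b, HasDerivAt g (B - g t ^ 2) t ∧ ‖g t‖ ≤ M)
    (h : f t₀ = g t₀) : EqOn f g (Ioo a b) := by
  have hM : 0 ≤ M := (norm_nonneg _).trans (hf t₀ ht).2
  lift M to NNReal using hM
  exact ODE_solution_unique_of_mem_Ioo (v := fun _ X => B - X ^ 2)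
    (s := fun _ => closedBall 0 M) (fun t _ => riccati_lip B M) ht
    (fun t h => ⟨(hf t h).1, mem_closedBall_zero_iff.2 (hf t h).2⟩)
    (fun t h => ⟨(hg t h).1, mem_closedBall_zero_iff.2 (hg t h).2⟩) h

lemma norm_le_of_quad {E : Type*} [NormedAddCommGroup E] [InnerProductSpace ℝ E]
    (S : E →L[ℝ] E) (c : ℝ) (hc : 0 < c)
    (hs : ∀ u v : E, (inner ℝ (S u) v : ℝ) = inner ℝ u (S v))
    (h0 : ∀ u : E, 0 ≤ (inner ℝ (S u) u : ℝ))
    (h1 : ∀ u : E, (inner ℝ (S u) u : ℝ) ≤ c * ‖u‖ ^ 2) : ‖S‖ ≤ c := by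
  refine S.opNorm_le_bound hc.le fun u => ?_
  have key : ∀ v : E, 4 * (inner ℝ (S u) v : ℝ) ≤ 2 * c * (‖u‖ ^ 2 + ‖v‖ ^ 2) := by
    intro v
    have e1 := h1 (u + v)
    have e2 := h0 (u - v)
    have e3 := parallelogram_law_with_norm ℝ u v
    have e4 : (inner ℝ (S v) u : ℝ) = inner ℝ (S u) v := by
      rw [hs v u, real_inner_comm]
    simp only [map_add, map_sub, inner_add_left, inner_add_right, inner_sub_left,
      inner_sub_right] at e1 e2
    have e5 : ‖u + v‖ ^ 2 ≤ 2 * (‖u‖ ^ 2 + ‖v‖ ^ 2) := by nlinarith [sq_nonneg ‖u - v‖]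
    have e6 := mul_le_mul_of_nonneg_left e5 hc.le
    linarith
  have k := key (c⁻¹ • S u)
  rw [inner_smul_right, real_inner_self_eq_norm_sq, norm_smul, Real.norm_of_nonneg (by positivity),
    mul_pow] at k
  have k2 : ‖S u‖ ^ 2 ≤ (c * ‖u‖) ^ 2 := by
    have := mul_le_mul_of_nonneg_left k hc.le
    have i1 : c * (4 * (c⁻¹ * ‖S u‖ ^ 2)) = 4 * ‖S u‖ ^ 2 := by field_simp
    have i2 : c * (2 * c * (‖u‖ ^ 2 + c⁻¹ ^ 2 * ‖S u‖ ^ 2))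
      = 2 * (c * ‖u‖) ^ 2 + 2 * ‖S u‖ ^ 2 := by field_simp
    linarith
  exact le_of_sq_le_sq k2 (by positivity)

/-- Let `E` be a finite-dimensional real inner product space, `A` self-adjoint with
`a·id ≤ A ≤ b·id`, `0 < a ≤ b`, and `0 < T < ∞`. If `S : (0,T) → End(E)` is a
differentiable family of self-adjoint endomorphisms satisfying the Riccati equation
`S' = A² − S²` and `a tanh(at)·id ≤ S(t) ≤ b coth(bt)·id` on `(0,T)`, then `S` is not
a maximal solution: it extends to a solution with self-adjoint values on some `(0,T')`
with `T' > T`. -/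
theorem riccati_solution_extends
    {E : Type*} [NormedAddCommGroup E] [InnerProductSpace ℝ E] [FiniteDimensional ℝ E]
    (a b T : ℝ) (ha : 0 < a) (hab : a ≤ b) (hT : 0 < T)
    (A : E →L[ℝ] E)
    (hAsym : ∀ u v : E, (inner ℝ (A u) v : ℝ) = inner ℝ u (A v))
    (hAa : ∀ u : E, a * ‖u‖ ^ 2 ≤ (inner ℝ (A u) u : ℝ))
    (hAb : ∀ u : E, (inner ℝ (A u) u : ℝ) ≤ b * ‖u‖ ^ 2)
    (S : ℝ → (E →L[ℝ] E))
    (hS : ∀ t : ℝ, 0 < t → t < T → HasDerivAt S (A ^ 2 - (S t) ^ 2) t)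
    (hSsym : ∀ t : ℝ, 0 < t → t < T → ∀ u v : E, (inner ℝ (S t u) v : ℝ) = inner ℝ u (S t v))
    (hSlow : ∀ t : ℝ, 0 < t → t < T → ∀ u : E,
      a * Real.tanh (a * t) * ‖u‖ ^ 2 ≤ (inner ℝ (S t u) u : ℝ))
    (hSup : ∀ t : ℝ, 0 < t → t < T → ∀ u : E,
      (inner ℝ (S t u) u : ℝ) ≤ b * Real.coth (b * t) * ‖u‖ ^ 2) :
    ∃ T' : ℝ, T < T' ∧ ∃ S' : ℝ → (E →L[ℝ] E),
      (∀ t : ℝ, 0 < t → t < T' →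
        HasDerivAt S' (A ^ 2 - (S' t) ^ 2) t ∧
          ∀ u v : E, (inner ℝ (S' t u) v : ℝ) = inner ℝ u (S' t v)) ∧
      ∀ t : ℝ, 0 < t → t < T → S' t = S t := by
  have hb : 0 < b := ha.trans_le hab
  set c : ℝ := b * (Real.cosh (b * T) / Real.sinh (b * (T / 2))) with hcdef
  have hsh : 0 < Real.sinh (b * (T / 2)) := Real.sinh_pos_iff.2 (by positivity)
  have hc : 0 < c := by have := Real.cosh_pos (b * T); positivity
  have hbound : ∀ t, T / 2 ≤ t → t < T → ‖S t‖ ≤ c := by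
    intro t h1 h2
    have h0 : 0 < t := by linarith
    apply norm_le_of_quad _ _ hc (hSsym t h0 h2)
    · intro u
      refine le_trans ?_ (hSlow t h0 h2 u)
      have : 0 ≤ Real.tanh (a * t) := by
        rw [Real.tanh_eq_sinh_div_cosh]
        exact div_nonneg (Real.sinh_nonneg_iff.2 (by positivity)) (Real.cosh_pos _).le
      positivity
    · intro u
      refine (hSup t h0 h2 u).trans ?_
      apply mul_le_mul_of_nonneg_right _ (sq_nonneg _)
      apply mul_le_mul_of_nonneg_left _ hb.le
      unfold Real.coth
      apply div_le_div₀ (Real.cosh_pos _).le _ hsh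
      · exact Real.sinh_le_sinh.2 (mul_le_mul_of_nonneg_left h1 hb.le)
      · rw [Real.cosh_le_cosh, abs_of_pos (by positivity), abs_of_pos (by positivity)]
        exact mul_le_mul_of_nonneg_left h2.le hb.le
  obtain ⟨ε, hε, hex⟩ := riccati_exists (A ^ 2) ⟨c, hc.le⟩
  obtain ⟨δ, hδ, hδε, hδT⟩ : ∃ δ > 0, δ ≤ ε ∧ δ ≤ T / 4 :=
    ⟨min ε (T / 4), by positivity, min_le_left _ _, min_le_right _ _⟩
  set t₀ := T - δ / 2 with ht₀
  obtain ⟨α, hα0, hα⟩ := hex t₀ (S t₀) (hbound t₀ (by linarith) (by linarith))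
  have hαd : ∀ t ∈ Ioo (t₀ - δ) (t₀ + δ), HasDerivAt α (A ^ 2 - α t ^ 2) t := by
    intro t ht
    exact (hα t ⟨by linarith [ht.1], by linarith [ht.2]⟩).hasDerivAt
      (Icc_mem_nhds (by linarith [ht.1]) (by linarith [ht.2]))
  have hcont : ContinuousOn α (Icc (t₀ - ε) (t₀ + ε)) := HasDerivWithinAt.continuousOn hα
  obtain ⟨C, hC⟩ := isCompact_Icc.exists_bound_of_continuousOn hcont
  have hCb : ∀ t ∈ Ioo (t₀ - δ) (t₀ + δ), ‖α t‖ ≤ C := fun t ht =>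
    hC t ⟨by linarith [ht.1], by linarith [ht.2]⟩
  -- agreement with `S`
  have hagree : EqOn α S (Ioo (t₀ - δ) T) := by
    apply riccati_unique (A ^ 2) (max C c) (t₀ := t₀) ⟨by linarith, by linarith⟩ _ _ hα0
    · intro t ht
      have ht' : t ∈ Ioo (t₀ - δ) (t₀ + δ) := ⟨ht.1, by linarith [ht.2]⟩
      exact ⟨hαd t ht', (hCb t ht').trans (le_max_left _ _)⟩
    · intro t ht
      exact ⟨hS t (by linarith [ht.1]) ht.2,
        (hbound t (by linarith [ht.1]) ht.2).trans (le_max_right _ _)⟩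
  -- self-adjointness
  have hadj : ∀ X : E →L[ℝ] E, (∀ u v : E, (inner ℝ (X u) v : ℝ) = inner ℝ u (X v)) ↔
      star X = X := by
    intro X
    rw [ContinuousLinearMap.star_eq_adjoint, eq_comm, ContinuousLinearMap.eq_adjoint_iff]
  have hsa : EqOn (fun t => star (α t)) α (Ioo (t₀ - δ) (t₀ + δ)) := by
    apply riccati_unique (A ^ 2) C (t₀ := t₀) ⟨by linarith, by linarith⟩
    · intro t ht
      refine ⟨?_, (ContinuousLinearMap.adjoint.norm_map (α t)).le.trans (hCb t ht)⟩
      have h := (hαd t ht).star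
      have e : star (A ^ 2 - α t ^ 2) = A ^ 2 - star (α t) ^ 2 := by
        rw [star_sub, star_pow, star_pow, (hadj A).1 hAsym]
      rwa [e] at h
    · exact fun t ht => ⟨hαd t ht, hCb t ht⟩
    · show star (α t₀) = α t₀
      rw [hα0]
      exact (hadj _).1 (hSsym t₀ (by linarith) (by linarith))
  refine ⟨t₀ + δ, by linarith, fun t => if t < T then S t else α t, ?_, ?_⟩
  · intro t h0 h1
    by_cases h : t < T
    · simp only [if_pos h]
      refine ⟨(hS t h0 h).congr_of_eventuallyEq ?_, hSsym t h0 h⟩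
      filter_upwards [Iio_mem_nhds h] with x hx
      exact if_pos hx
    · have ht : t ∈ Ioo (t₀ - δ) (t₀ + δ) := ⟨by linarith, h1⟩
      simp only [if_neg h]
      refine ⟨(hαd t ht).congr_of_eventuallyEq ?_, (hadj _).2 (hsa ht)⟩
      filter_upwards [Ioo_mem_nhds ht.1 ht.2] with x hx
      split_ifs with hxT
      · exact (hagree ⟨hx.1, hxT⟩).symm
      · rfl
  · intro t _ h
    exact if_pos h
end

section
/- Let E be a real inner product space of finite dimension m, let A be a self-adjoint endomorphism of E, and let α₁ ≥ α₂ ≥ … ≥ α_m be its eigenvalues listed with multiplicity in decreasing order. Then for every 0 ≤ k ≤ m, δ_k(A) = Σ_{i=k+1}^{m} α_i − Σ_{i=1}^{k} α_i; that is, the minimum over all (m−k)-dimensional subspaces L of tr(A|_L) − tr(A|_{L^⊥}) equals the sum of the m−k smallest eigenvalues of A minus the sum of the k largest eigenvalues of A. -/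
/-- The trace of a self-adjoint endomorphism `A` restricted to a subspace `L`,
computed as `∑ᵢ ⟨A uᵢ, uᵢ⟩` for an orthonormal basis `(uᵢ)` of `L`. -/
noncomputable def trRestrict {E : Type*} [NormedAddCommGroup E] [InnerProductSpace ℝ E]
    [FiniteDimensional ℝ E] (A : E →ₗ[ℝ] E) (L : Submodule ℝ E) : ℝ :=
  ∑ i, (inner ℝ (A ((stdOrthonormalBasis ℝ L i : L) : E))
    ((stdOrthonormalBasis ℝ L i : L) : E) : ℝ)

/-- `δ_k(A)`: the infimum over all subspaces `L` of codimension `k`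
of `tr(A|_L) − tr(A|_{L^⊥})`. -/
noncomputable def deltaK {E : Type*} [NormedAddCommGroup E] [InnerProductSpace ℝ E]
    [FiniteDimensional ℝ E] (A : E →ₗ[ℝ] E) (k : ℕ) : ℝ :=
  sInf ((fun L : Submodule ℝ E => trRestrict A L - trRestrict A Lᗮ) ''
    {L : Submodule ℝ E | Module.finrank ℝ L = Module.finrank ℝ E - k})

section Aux

variable {E : Type*} [NormedAddCommGroup E] [InnerProductSpace ℝ E] [FiniteDimensional ℝ E]

/-- The squared norm of the projection of `b j` on `L`. -/
noncomputable def projWeight (L : Submodule ℝ E) (x : E) : ℝ := ‖L.starProjection x‖ ^ 2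

theorem projWeight_eq_sum (L : Submodule ℝ E) (x : E) :
    projWeight L x = ∑ i, (inner ℝ ((stdOrthonormalBasis ℝ L i : L) : E) x : ℝ) ^ 2 := by
  have h := (stdOrthonormalBasis ℝ L).sum_sq_inner_right (L.orthogonalProjectionOnto x)
  unfold projWeight
  rw [Submodule.starProjection_apply, ← Submodule.coe_norm, ← h]
  refine Finset.sum_congr rfl fun i _ => ?_
  rw [Submodule.inner_orthogonalProjectionOnto_eq_of_mem_left]

theorem projWeight_add_orthogonal (L : Submodule ℝ E) (x : E) :
    projWeight L x + projWeight Lᗮ x = ‖x‖ ^ 2 := by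
  have h := L.norm_sq_eq_add_norm_sq_projection x
  simp only [projWeight, Submodule.starProjection_apply]
  simpa using h.symm

theorem sum_projWeight {m : ℕ} (b : OrthonormalBasis (Fin m) ℝ E) (L : Submodule ℝ E) :
    ∑ j, projWeight L (b j) = Module.finrank ℝ L := by
  simp_rw [projWeight_eq_sum]
  rw [Finset.sum_comm]
  simp_rw [b.sum_sq_inner_left]
  have : ∀ i, ‖((stdOrthonormalBasis ℝ L i : L) : E)‖ = 1 := fun i => by
    rw [← Submodule.coe_norm]; exact (stdOrthonormalBasis ℝ L).norm_eq_one i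
  simp [this]

theorem trRestrict_eq_sum {m : ℕ} (A : E →ₗ[ℝ] E)
    (hAsym : ∀ u v : E, (inner ℝ (A u) v : ℝ) = inner ℝ u (A v))
    (α : Fin m → ℝ) (b : OrthonormalBasis (Fin m) ℝ E) (hb : ∀ i, A (b i) = α i • b i)
    (L : Submodule ℝ E) :
    trRestrict A L = ∑ j, α j * projWeight L (b j) := by
  simp_rw [projWeight_eq_sum, Finset.mul_sum]
  rw [Finset.sum_comm]
  unfold trRestrict
  refine Finset.sum_congr rfl fun i _ => ?_
  rw [← b.sum_inner_mul_inner]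
  refine Finset.sum_congr rfl fun j _ => ?_
  rw [hAsym, hb, inner_smul_right, real_inner_comm _ (b j)]
  ring

theorem trRestrict_sub_eq {m : ℕ} (A : E →ₗ[ℝ] E)
    (hAsym : ∀ u v : E, (inner ℝ (A u) v : ℝ) = inner ℝ u (A v))
    (α : Fin m → ℝ) (b : OrthonormalBasis (Fin m) ℝ E) (hb : ∀ i, A (b i) = α i • b i)
    (L : Submodule ℝ E) :
    trRestrict A L - trRestrict A Lᗮ = ∑ j, α j * (2 * projWeight L (b j) - 1) := by
  rw [trRestrict_eq_sum A hAsym α b hb, trRestrict_eq_sum A hAsym α b hb, ← Finset.sum_sub_distrib]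
  refine Finset.sum_congr rfl fun j _ => ?_
  have h := projWeight_add_orthogonal L (b j)
  rw [b.norm_eq_one] at h
  have : projWeight Lᗮ (b j) = 1 - projWeight L (b j) := by linarith
  rw [this]; ring

theorem projWeight_nonneg (L : Submodule ℝ E) (x : E) : 0 ≤ projWeight L x := by
  unfold projWeight; positivity

theorem exists_threshold {m : ℕ} (α : Fin m → ℝ) (hα : Antitone α) (k : ℕ) :
    ∃ t : ℝ, ∀ j : Fin m, (k ≤ (j : ℕ) → α j ≤ t) ∧ ((j : ℕ) < k → t ≤ α j) := by
  by_cases h : k < m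
  · refine ⟨α ⟨k, h⟩, fun j => ⟨fun hj => hα hj, fun hj => hα (le_of_lt hj)⟩⟩
  · obtain ⟨t, ht⟩ := (Set.finite_range α).bddBelow
    refine ⟨t, fun j => ⟨fun hj => ?_, fun _ => ht ⟨j, rfl⟩⟩⟩
    have := j.2
    omega

theorem sum_ind {m : ℕ} (k : ℕ) (hk : k ≤ m) :
    ∑ j : Fin m, (if k ≤ (j : ℕ) then (1 : ℝ) else 0) = ((m - k : ℕ) : ℝ) := by
  rw [Fin.sum_univ_eq_sum_range (fun j => if k ≤ j then (1 : ℝ) else 0) m, ← Finset.sum_filter]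
  have : (Finset.range m).filter (fun j => k ≤ j) = Finset.Ico k m := by
    ext j; simp; omega
  simp [this]

end Aux

/-- If `A` is self-adjoint with eigenvalues `α₁ ≥ … ≥ α_m` listed with multiplicity,
then for every `0 ≤ k ≤ m`, `δ_k(A)` equals the sum of the `m−k` smallest eigenvalues
of `A` minus the sum of the `k` largest eigenvalues of `A`. -/
theorem deltaK_eq_eigenvalue_sums
    {E : Type*} [NormedAddCommGroup E] [InnerProductSpace ℝ E] [FiniteDimensional ℝ E]
    {m : ℕ} (hm : Module.finrank ℝ E = m)
    (A : E →ₗ[ℝ] E) (hAsym : ∀ u v : E, (inner ℝ (A u) v : ℝ) = inner ℝ u (A v))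
    (α : Fin m → ℝ) (hα : Antitone α)
    (b : OrthonormalBasis (Fin m) ℝ E) (hb : ∀ i, A (b i) = α i • b i)
    (k : ℕ) (hk : k ≤ m) :
    deltaK A k =
      (∑ i ∈ Finset.univ.filter (fun i : Fin m => k ≤ (i : ℕ)), α i) -
        ∑ i ∈ Finset.univ.filter (fun i : Fin m => (i : ℕ) < k), α i := by
  classical
  set d : Fin m → ℝ := fun j => if k ≤ (j : ℕ) then (1 : ℝ) else 0 with hd
  have hR : (∑ i ∈ Finset.univ.filter (fun i : Fin m => k ≤ (i : ℕ)), α i) -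
        ∑ i ∈ Finset.univ.filter (fun i : Fin m => (i : ℕ) < k), α i
      = ∑ j, α j * (2 * d j - 1) := by
    rw [Finset.sum_filter, Finset.sum_filter, ← Finset.sum_sub_distrib]
    refine Finset.sum_congr rfl fun j _ => ?_
    by_cases h : k ≤ (j : ℕ)
    · simp [hd, h, not_lt.mpr h]; ring
    · simp [hd, h, not_le.mp h]
  rw [hR]
  unfold deltaK
  refine IsLeast.csInf_eq ⟨?_, ?_⟩
  · set L : Submodule ℝ E := Submodule.span ℝ (b '' {j | k ≤ (j : ℕ)}) with hL
    have hw : ∀ j, projWeight L (b j) = d j := by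
      intro j
      by_cases h : k ≤ (j : ℕ)
      · have hm' : b j ∈ L := Submodule.subset_span ⟨j, h, rfl⟩
        simp [projWeight, hd, h, Submodule.starProjection_eq_self_iff.mpr hm']
      · have hm' : b j ∈ Lᗮ := by
          rw [hL, Submodule.mem_orthogonal]
          intro u hu
          induction hu using Submodule.span_induction with
          | mem x hx =>
            obtain ⟨i, hi, rfl⟩ := hx
            refine b.inner_eq_zero ?_
            rintro rfl
            exact h hi
          | zero => simp
          | add x y _ _ hx hy => rw [inner_add_left, hx, hy, add_zero]
          | smul a x _ hx => rw [inner_smul_left, hx, mul_zero]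
        simp [projWeight, hd, h, (Submodule.starProjection_apply_eq_zero_iff L).mpr hm']
    refine ⟨L, ?_, ?_⟩
    · have h1 := sum_projWeight b L
      simp_rw [hw] at h1
      rw [hd, sum_ind k hk] at h1
      rw [Set.mem_setOf_eq, hm]
      exact_mod_cast h1.symm
    · simp only [trRestrict_sub_eq A hAsym α b hb, hw]
  · rintro _ ⟨L, hLk, rfl⟩
    rw [Set.mem_setOf_eq, hm] at hLk
    simp only [trRestrict_sub_eq A hAsym α b hb]
    obtain ⟨t, ht⟩ := exists_threshold α hα k
    have h1 := sum_projWeight b L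
    rw [hLk, ← sum_ind k hk] at h1
    have h2 : 0 ≤ ∑ j, (α j - t) * (projWeight L (b j) - d j) := by
      refine Finset.sum_nonneg fun j _ => ?_
      by_cases h : k ≤ (j : ℕ)
      · have h3 := projWeight_add_orthogonal L (b j)
        rw [b.norm_eq_one] at h3
        have h4 := projWeight_nonneg Lᗮ (b j)
        have h5 := (ht j).1 h
        simp only [hd, h, if_true]
        exact mul_nonneg_of_nonpos_of_nonpos (by linarith) (by linarith)
      · have h5 := (ht j).2 (not_le.mp h)
        simp only [hd, h, if_false]
        exact mul_nonneg (by linarith) (by linarith [projWeight_nonneg L (b j)])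
    have h3 : ∑ j, (α j - t) * (projWeight L (b j) - d j) =
        (∑ j, α j * (projWeight L (b j) - d j))
          - t * (∑ j, projWeight L (b j) - ∑ j, d j) := by
      rw [← Finset.sum_sub_distrib, Finset.mul_sum, ← Finset.sum_sub_distrib]
      exact Finset.sum_congr rfl fun j _ => by ring
    rw [h3, h1, sub_self, mul_zero, sub_zero] at h2
    have h4 : ∑ j, α j * (2 * projWeight L (b j) - 1) - ∑ j, α j * (2 * d j - 1)
        = 2 * ∑ j, α j * (projWeight L (b j) - d j) := by
      rw [← Finset.sum_sub_distrib, Finset.mul_sum]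
      exact Finset.sum_congr rfl fun j _ => by ring
    linarith
end

section
/- Let E be a real inner product space of finite dimension m, let 0 < a ≤ b, and let A be a self-adjoint endomorphism of E for which there is a unit vector v ∈ E with Av = 0 and a‖u‖² ≤ ⟨Au,u⟩ ≤ b‖u‖² for all u ∈ E orthogonal to v. Then for every 0 ≤ k ≤ m, δ_k(A) ≥ (m−k−1)a − kb. -/
theorem quad_eq_aux {E : Type*} [NormedAddCommGroup E] [InnerProductSpace ℝ E]
    (A : E →ₗ[ℝ] E) (hAsym : ∀ u v : E, (inner ℝ (A u) v : ℝ) = inner ℝ u (A v))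
    (v : E) (hv : ‖v‖ = 1) (hAv : A v = 0) (u : E) (hu : ‖u‖ = 1) :
    ∃ w : E, (inner ℝ w v : ℝ) = 0 ∧ ‖w‖ ^ 2 = 1 - (inner ℝ u v : ℝ) ^ 2 ∧
      (inner ℝ (A w) w : ℝ) = inner ℝ (A u) u := by
  have hvv : (inner ℝ v v : ℝ) = 1 := by rw [real_inner_self_eq_norm_sq, hv]; norm_num
  have huu : (inner ℝ u u : ℝ) = 1 := by rw [real_inner_self_eq_norm_sq, hu]; norm_num
  refine ⟨u - (inner ℝ u v : ℝ) • v, ?_, ?_, ?_⟩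
  · rw [inner_sub_left, real_inner_smul_left, hvv]; ring
  · rw [← real_inner_self_eq_norm_sq, inner_sub_left, inner_sub_right, inner_sub_right]
    simp only [real_inner_smul_left, real_inner_smul_right, hvv, huu, real_inner_comm u v]
    ring
  · have h0 : (inner ℝ (A u) v : ℝ) = 0 := by rw [hAsym, hAv, inner_zero_right]
    rw [map_sub, map_smul, hAv, smul_zero, sub_zero, inner_sub_right, real_inner_smul_right, h0]
    ring

theorem exists_sub_aux {E : Type*} [NormedAddCommGroup E] [InnerProductSpace ℝ E]
    [FiniteDimensional ℝ E] (n : ℕ) (hn : n ≤ Module.finrank ℝ E) :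
    ∃ L : Submodule ℝ E, Module.finrank ℝ L = n := by
  have hli := (Module.finBasis ℝ E).linearIndependent.comp (Fin.castLE hn)
    (Fin.castLE_injective hn)
  exact ⟨_, (finrank_span_eq_card hli).trans (by simp)⟩

theorem orth_aux {E : Type*} [NormedAddCommGroup E] [InnerProductSpace ℝ E]
    [FiniteDimensional ℝ E] (L : Submodule ℝ E) :
    Orthonormal ℝ (fun i => ((stdOrthonormalBasis ℝ L i : L) : E)) :=
  (stdOrthonormalBasis ℝ L).orthonormal.comp_linearIsometry L.subtypeₗᵢ

/-- Let `E` have dimension `m`, let `0 < a ≤ b`, and let `A` be self-adjoint with a unit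
vector `v` such that `Av = 0` and `a‖u‖² ≤ ⟨Au,u⟩ ≤ b‖u‖²` for all `u ⊥ v`. Then
`δ_k(A) ≥ (m−k−1)a − kb` for every `0 ≤ k ≤ m`. -/
theorem deltaK_lower_bound_pinched
    {E : Type*} [NormedAddCommGroup E] [InnerProductSpace ℝ E] [FiniteDimensional ℝ E]
    {m : ℕ} (hm : Module.finrank ℝ E = m)
    (a b : ℝ) (ha : 0 < a) (hab : a ≤ b)
    (A : E →ₗ[ℝ] E) (hAsym : ∀ u v : E, (inner ℝ (A u) v : ℝ) = inner ℝ u (A v))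
    (v : E) (hv : ‖v‖ = 1) (hAv : A v = 0)
    (hlow : ∀ u : E, (inner ℝ u v : ℝ) = 0 → a * ‖u‖ ^ 2 ≤ (inner ℝ (A u) u : ℝ))
    (hup : ∀ u : E, (inner ℝ u v : ℝ) = 0 → (inner ℝ (A u) u : ℝ) ≤ b * ‖u‖ ^ 2)
    (k : ℕ) (hk : k ≤ m) :
    ((m : ℝ) - k - 1) * a - k * b ≤ deltaK A k := by
  have hlo : ∀ L : Submodule ℝ E, ((Module.finrank ℝ L : ℝ) - 1) * a ≤ trRestrict A L := by
    intro L
    have hB := (orth_aux L).sum_inner_products_le (s := Finset.univ) v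
    have h1 : ∀ i, a * (1 - ‖(inner ℝ ((stdOrthonormalBasis ℝ L i : L) : E) v : ℝ)‖ ^ 2) ≤
        (inner ℝ (A ((stdOrthonormalBasis ℝ L i : L) : E))
          ((stdOrthonormalBasis ℝ L i : L) : E) : ℝ) := by
      intro i
      obtain ⟨w, hw, hn, he⟩ := quad_eq_aux A hAsym v hv hAv _ ((orth_aux L).1 i)
      have := hlow w hw
      rw [hn, he] at this
      rwa [Real.norm_eq_abs, sq_abs]
    have h2 := Finset.sum_le_sum (s := Finset.univ) (fun i _ => h1 i)
    rw [← Finset.mul_sum, Finset.sum_sub_distrib] at h2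
    simp only [Finset.sum_const, Finset.card_univ, Fintype.card_fin, nsmul_eq_mul, mul_one] at h2
    rw [hv] at hB
    unfold trRestrict
    nlinarith
  have hhi : ∀ L : Submodule ℝ E, trRestrict A L ≤ (Module.finrank ℝ L : ℝ) * b := by
    intro L
    have h1 : ∀ i, (inner ℝ (A ((stdOrthonormalBasis ℝ L i : L) : E))
          ((stdOrthonormalBasis ℝ L i : L) : E) : ℝ) ≤ b := by
      intro i
      obtain ⟨w, hw, hn, he⟩ := quad_eq_aux A hAsym v hv hAv _ ((orth_aux L).1 i)
      have := hup w hw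
      rw [hn, he] at this
      nlinarith [sq_nonneg (inner ℝ ((stdOrthonormalBasis ℝ L i : L) : E) v : ℝ)]
    have h2 := Finset.sum_le_sum (s := Finset.univ) (fun i _ => h1 i)
    simpa [trRestrict] using h2
  unfold deltaK
  apply le_csInf
  · obtain ⟨L, hL⟩ := exists_sub_aux (E := E) (Module.finrank ℝ E - k) (Nat.sub_le _ _)
    exact ⟨_, L, hL, rfl⟩
  · rintro _ ⟨L, hL, rfl⟩
    simp only [Set.mem_setOf_eq] at hL
    have hs := L.finrank_add_finrank_orthogonal
    have hk2 : Module.finrank ℝ Lᗮ = k := by omega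
    have hL2 : (Module.finrank ℝ L : ℝ) = (m : ℝ) - k := by
      rw [hL, hm, Nat.cast_sub hk]
    have e1 := hlo L
    have e2 := hhi Lᗮ
    rw [hL2] at e1
    rw [hk2] at e2
    simp only
    linarith
end

section
/- Let E be a finite-dimensional real inner product space and let J be an orthogonal endomorphism of E with J² = −id. Let V ∈ E be a unit vector and let A be a self-adjoint endomorphism of E such that AV = 0, A(JV) = 2·JV, and Au = u for every u ∈ E orthogonal to both V and JV. Then A + J⁻¹ ∘ A ∘ J = 2·id on all of E. -/
/-- Let `E` be a finite-dimensional real inner product space with an orthogonal complex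
structure `J` (`J² = −id`), let `V` be a unit vector and `A` a self-adjoint
endomorphism with `AV = 0`, `A(JV) = 2 JV`, and `Au = u` for every `u` orthogonal to
both `V` and `JV`. Then `A + J⁻¹ ∘ A ∘ J = 2·id`. -/
theorem complex_structure_sum_identity
    {E : Type*} [NormedAddCommGroup E] [InnerProductSpace ℝ E] [FiniteDimensional ℝ E]
    (J : E ≃ₗᵢ[ℝ] E) (hJ : ∀ u : E, J (J u) = -u)
    (V : E) (hV : ‖V‖ = 1)
    (A : E →ₗ[ℝ] E) (hAsym : ∀ u v : E, (inner ℝ (A u) v : ℝ) = inner ℝ u (A v))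
    (hAV : A V = 0) (hAJV : A (J V) = (2 : ℝ) • (J V))
    (hperp : ∀ u : E, (inner ℝ u V : ℝ) = 0 → (inner ℝ u (J V) : ℝ) = 0 → A u = u) :
    ∀ u : E, A u + J.symm (A (J u)) = (2 : ℝ) • u := by
  have hJi : ∀ x y : E, (inner ℝ (J x) y : ℝ) = -inner ℝ x (J y) := by
    intro x y
    have h := J.inner_map_map (J x) y
    rw [hJ, inner_neg_left] at h
    exact h.symm
  have hVV : (inner ℝ V V : ℝ) = 1 := by
    rw [real_inner_self_eq_norm_sq, hV]; norm_num
  have hJJ : (inner ℝ (J V) (J V) : ℝ) = 1 := by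
    rw [J.inner_map_map, hVV]
  have hVJ : (inner ℝ V (J V) : ℝ) = 0 := by
    have h := hJi V V
    rw [real_inner_comm] at h
    linarith
  have hJV : (inner ℝ (J V) V : ℝ) = 0 := by
    rw [real_inner_comm]; exact hVJ
  have hA : ∀ u : E, A u = u - (inner ℝ u V : ℝ) • V + (inner ℝ u (J V) : ℝ) • J V := by
    intro u
    have h := hperp (u - (inner ℝ u V : ℝ) • V - (inner ℝ u (J V) : ℝ) • J V)
      (by simp only [inner_sub_left, real_inner_smul_left, hVV, hJV]; ring)
      (by simp only [inner_sub_left, real_inner_smul_left, hVJ, hJJ]; ring)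
    rw [map_sub, map_sub, map_smul, map_smul, hAV, hAJV, smul_zero, sub_zero,
      sub_eq_iff_eq_add] at h
    rw [h]
    module
  have hs : ∀ x : E, J.symm x = -J x := by
    intro x
    apply J.injective
    rw [J.apply_symm_apply, map_neg, hJ, neg_neg]
  intro u
  rw [hs, hA (J u), hJi u V, J.inner_map_map, hA u]
  simp only [map_add, map_sub, map_smul, hJ]
  module
end

section
/- Let E be a finite-dimensional real inner product space, and let I and J be orthogonal endomorphisms of E with I² = J² = −id and I∘J = −J∘I; set K = I∘J. Let V ∈ E be a unit vector and let A be a self-adjoint endomorphism of E such that AV = 0, A(IV) = 2·IV, A(JV) = 2·JV, A(KV) = 2·KV, and Au = u for every u ∈ E orthogonal to all of V, IV, JV, KV. Then the endomorphism B = A + I⁻¹∘A∘I + J⁻¹∘A∘J + K⁻¹∘A∘K equals 6·id on the subspace span{V, IV, JV, KV} and equals 4·id on its orthogonal complement; in particular ⟨Bu,u⟩ ≥ 4‖u‖² for all u ∈ E. -/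
/-- Let `E` be a finite-dimensional real inner product space with a quaternionic
structure given by orthogonal endomorphisms `I`, `J` with `I² = J² = −id` and
`IJ = −JI`, and `K = I∘J`. Let `V` be a unit vector and `A` a self-adjoint
endomorphism with `AV = 0`, `A(IV) = 2 IV`, `A(JV) = 2 JV`, `A(KV) = 2 KV`, and
`Au = u` for all `u` orthogonal to `V, IV, JV, KV`. Then
`B = A + I⁻¹AI + J⁻¹AJ + K⁻¹AK` equals `6·id` on `span{V, IV, JV, KV}` and `4·id` on
its orthogonal complement; in particular `⟨Bu,u⟩ ≥ 4‖u‖²` for all `u`. -/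
theorem quaternionic_structure_sum_identity
    {E : Type*} [NormedAddCommGroup E] [InnerProductSpace ℝ E] [FiniteDimensional ℝ E]
    (I J : E ≃ₗᵢ[ℝ] E) (hI : ∀ u : E, I (I u) = -u) (hJ : ∀ u : E, J (J u) = -u)
    (hIJ : ∀ u : E, I (J u) = -J (I u))
    (V : E) (hV : ‖V‖ = 1)
    (A : E →ₗ[ℝ] E) (hAsym : ∀ u v : E, (inner ℝ (A u) v : ℝ) = inner ℝ u (A v))
    (hAV : A V = 0) (hAIV : A (I V) = (2 : ℝ) • (I V))
    (hAJV : A (J V) = (2 : ℝ) • (J V)) (hAKV : A (I (J V)) = (2 : ℝ) • (I (J V)))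
    (hperp : ∀ u : E, (inner ℝ u V : ℝ) = 0 → (inner ℝ u (I V) : ℝ) = 0 →
      (inner ℝ u (J V) : ℝ) = 0 → (inner ℝ u (I (J V)) : ℝ) = 0 → A u = u)
    (B : E → E)
    (hB : ∀ u : E, B u =
      A u + I.symm (A (I u)) + J.symm (A (J u)) + J.symm (I.symm (A (I (J u))))) :
    (∀ u ∈ Submodule.span ℝ ({V, I V, J V, I (J V)} : Set E), B u = (6 : ℝ) • u) ∧
      (∀ u ∈ (Submodule.span ℝ ({V, I V, J V, I (J V)} : Set E))ᗮ,
        B u = (4 : ℝ) • u) ∧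
      ∀ u : E, 4 * ‖u‖ ^ 2 ≤ (inner ℝ (B u) u : ℝ) := by
  have hIs : ∀ u : E, I.symm u = -I u := fun u => by
    rw [LinearIsometryEquiv.symm_apply_eq, map_neg, hI, neg_neg]
  have hJs : ∀ u : E, J.symm u = -J u := fun u => by
    rw [LinearIsometryEquiv.symm_apply_eq, map_neg, hJ, neg_neg]
  have hJI : ∀ u : E, J (I u) = -I (J u) := fun u => by rw [hIJ, neg_neg]
  have iI : ∀ u v : E, (inner ℝ (I u) v : ℝ) = -inner ℝ u (I v) := fun u v => by
    have h := I.inner_map_map u (I v)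
    rw [hI, inner_neg_right] at h
    linarith
  have iJ : ∀ u v : E, (inner ℝ (J u) v : ℝ) = -inner ℝ u (J v) := fun u v => by
    have h := J.inner_map_map u (J v)
    rw [hJ, inner_neg_right] at h
    linarith
  have hB' : ∀ u : E, B u = A u - I (A (I u)) - J (A (J u)) + J (I (A (I (J u)))) := by
    intro u
    rw [hB]
    simp only [hIs, hJs, map_neg, neg_neg]
    abel
  have h6 : ∀ u ∈ Submodule.span ℝ ({V, I V, J V, I (J V)} : Set E), B u = (6 : ℝ) • u := by
    intro u hu
    induction hu using Submodule.span_induction with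
    | mem x hx =>
      simp only [Set.mem_insert_iff, Set.mem_singleton_iff] at hx
      rw [hB']
      rcases hx with rfl | rfl | rfl | rfl <;>
        simp only [hI, hJ, hJI, hAV, hAIV, hAJV, hAKV, map_neg, map_smul, map_zero] <;> module
    | zero => simp [hB']
    | add x y _ _ hx hy =>
      have : B (x + y) = B x + B y := by
        simp only [hB', map_add]; abel
      rw [this, hx, hy, smul_add]
    | smul a x _ hx =>
      have : B (a • x) = a • B x := by
        simp only [hB', map_smul, smul_add, smul_sub]
      rw [this, hx, smul_comm]
  have h4 : ∀ u ∈ (Submodule.span ℝ ({V, I V, J V, I (J V)} : Set E))ᗮ,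
      B u = (4 : ℝ) • u := by
    intro u hu
    rw [Submodule.mem_orthogonal'] at hu
    have h1 : inner ℝ u V = 0 := hu _ (Submodule.subset_span (by simp))
    have h2 : inner ℝ u (I V) = 0 := hu _ (Submodule.subset_span (by simp))
    have h3 : inner ℝ u (J V) = 0 := hu _ (Submodule.subset_span (by simp))
    have h5 : inner ℝ u (I (J V)) = 0 := hu _ (Submodule.subset_span (by simp))
    have e1 : A u = u := hperp u h1 h2 h3 h5
    have e2 : A (I u) = I u := by
      apply hperp <;> simp [iI, hI, h1, h2, h3, h5]
    have e3 : A (J u) = J u := by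
      apply hperp <;> simp [iJ, hJ, hJI, h1, h2, h3, h5]
    have e4 : A (I (J u)) = I (J u) := by
      apply hperp <;> simp [iI, iJ, hI, hJ, hJI, h1, h2, h3, h5]
    rw [hB', e1, e2, e3, e4]
    simp only [hI, hJ, map_neg]
    module
  refine ⟨h6, h4, fun u => ?_⟩
  obtain ⟨x, hx, y, hy, rfl⟩ :=
    (Submodule.span ℝ ({V, I V, J V, I (J V)} : Set E)).exists_add_mem_mem_orthogonal u
  have hadd : B (x + y) = B x + B y := by
    simp only [hB', map_add]; abel
  have hxy : inner ℝ x y = 0 := Submodule.inner_right_of_mem_orthogonal hx hy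
  have hyx : inner ℝ y x = 0 := Submodule.inner_left_of_mem_orthogonal hx hy
  rw [hadd, h6 x hx, h4 y hy, ← real_inner_self_eq_norm_sq]
  simp only [inner_add_left, inner_add_right, real_inner_smul_left, hxy, hyx]
  have := real_inner_self_nonneg (x := x)
  linarith
end
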